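/- For every integer k with 4 ≤ k ≤ 14 and every n ≥ 15, 𝓑_k^{00}(n) = ∅; that is, no graph B_k(n_1,…,n_k) of order n ≥ 15 satisfies λ_3 = λ_4 = 0. Consequently, for n ≥ 15 and 2 ≤ s ≤ n−3, there is no reduced X-complete graph in 𝒞𝒢^s(n). -/

import Mathlib

open Matrix BigOperators

namespace TwoPosEig

variable {V : Type*}

/-- The real adjacency matrix of a simple graph (classical decidability). -/
noncomputable def adjMat [Fintype V] [DecidableEq V] (G : SimpleGraph V) : Matrix V V ℝ :=
  letI := Classical.decRel G.Adj
  G.adjMatrix ℝ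

lemma adjMat_isHermitian [Fintype V] [DecidableEq V] (G : SimpleGraph V) :
    (adjMat G).IsHermitian := by
  letI := Classical.decRel G.Adj
  rw [Matrix.IsHermitian, Matrix.conjTranspose_eq_transpose_of_trivial]
  exact SimpleGraph.isSymm_adjMatrix G

/-- The eigenvalues of (the adjacency matrix of) a graph, as a function on vertices. -/
noncomputable def eigs [Fintype V] [DecidableEq V] (G : SimpleGraph V) : V → ℝ :=
  (adjMat_isHermitian G).eigenvalues

/-- `p(G)`: the number of positive eigenvalues (with multiplicity). -/
noncomputable def posCount [Finite V] (G : SimpleGraph V) : ℕ :=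
  letI := Fintype.ofFinite V
  letI := Classical.decEq V
  Nat.card {i : V // 0 < eigs G i}

/-- `η(G)`: the number of zero eigenvalues (with multiplicity), the nullity. -/
noncomputable def nullCount [Finite V] (G : SimpleGraph V) : ℕ :=
  letI := Fintype.ofFinite V
  letI := Classical.decEq V
  Nat.card {i : V // eigs G i = 0}

/-- `λ_k(G)`: the `k`-th largest eigenvalue (1-indexed); junk value `0` out of range. -/
noncomputable def lam [Finite V] (G : SimpleGraph V) (k : ℕ) : ℝ :=
  letI := Fintype.ofFinite V
  letI := Classical.decEq V
  (((Finset.univ.val.map (eigs G)).sort (· ≤ ·)).reverse).getD (k - 1) 0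

/-- Membership in `𝒢^s(n)` (the order `n` being the cardinality of the vertex type):
`p(G) = 2` and `η(G) = s`. -/
def memClass [Finite V] (s : ℕ) (G : SimpleGraph V) : Prop :=
  posCount G = 2 ∧ nullCount G = s

/-- `v` is a congruent vertex of I-type: some other vertex `u`, non-adjacent to `v`,
has the same neighbourhood. -/
def ITypeVertex (G : SimpleGraph V) (v : V) : Prop :=
  ∃ u, u ≠ v ∧ ¬ G.Adj u v ∧ G.neighborSet u = G.neighborSet v

/-- `u` is a congruent vertex of II-type: there are two non-adjacent vertices `v, w`
such that `N(u)` is a disjoint union of `N(v)` and `N(w)`. -/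
def IITypeVertex (G : SimpleGraph V) (u : V) : Prop :=
  ∃ v w, v ≠ w ∧ ¬ G.Adj v w ∧ Disjoint (G.neighborSet v) (G.neighborSet w) ∧
    G.neighborSet u = G.neighborSet v ∪ G.neighborSet w

/-- `u v x y` is a congruent (induced) quadrangle with congruent edges `uv`, `xy`. -/
def CongruentQuad (G : SimpleGraph V) (u v x y : V) : Prop :=
  u ≠ v ∧ u ≠ x ∧ u ≠ y ∧ v ≠ x ∧ v ≠ y ∧ x ≠ y ∧
  G.Adj u v ∧ G.Adj v x ∧ G.Adj x y ∧ G.Adj y u ∧ ¬ G.Adj u x ∧ ¬ G.Adj v y ∧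
  G.neighborSet u \ {y, v} = G.neighborSet v \ {u, x} ∧
  G.neighborSet x \ {v, y} = G.neighborSet y \ {x, u}

/-- A congruent vertex of III-type: a vertex of some congruent quadrangle. -/
def IIITypeVertex (G : SimpleGraph V) (z : V) : Prop :=
  ∃ u v x y, CongruentQuad G u v x y ∧ (z = u ∨ z = v ∨ z = x ∨ z = y)

/-- Membership in `𝒢_1^s(n)`: a connected graph obtained by adding a congruent vertex
of I-type to some graph in `𝒢^{s-1}(n-1)`. -/
def memG1 {n : ℕ} (s : ℕ) (G : SimpleGraph (Fin n)) : Prop :=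
  G.Connected ∧ ∃ v : Fin n, ITypeVertex G v ∧ memClass (s - 1) (G.induce {v}ᶜ)

/-- Membership in `𝒢_2^s(n)`. -/
def memG2 {n : ℕ} (s : ℕ) (G : SimpleGraph (Fin n)) : Prop :=
  G.Connected ∧ ∃ v : Fin n, IITypeVertex G v ∧ memClass (s - 1) (G.induce {v}ᶜ)

/-- Membership in `𝒢_3^s(n)`. -/
def memG3 {n : ℕ} (s : ℕ) (G : SimpleGraph (Fin n)) : Prop :=
  G.Connected ∧ ∃ v : Fin n, IIITypeVertex G v ∧ memClass (s - 1) (G.induce {v}ᶜ)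

/-- Oboudi's graph `G_m`: two cliques `K_{⌈m/2⌉}` (on `v_1, …`) and `K_{⌊m/2⌋}`
(on `w_1, …`), where `v_i ∼ w_j` iff `j ≥ ⌊m/2⌋ - i + 2` (1-indexed), i.e. (0-indexed)
`⌊m/2⌋ ≤ i + j`. -/
def oboudi (m : ℕ) : SimpleGraph (Fin ((m + 1) / 2) ⊕ Fin (m / 2)) :=
  SimpleGraph.fromRel fun a b =>
    match a, b with
    | Sum.inl _, Sum.inl _ => True
    | Sum.inr _, Sum.inr _ => True
    | Sum.inl i, Sum.inr j => m / 2 ≤ (i : ℕ) + (j : ℕ)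
    | Sum.inr _, Sum.inl _ => False

/-- The generalized lexicographic product `G[K_{t v}]`: each vertex `v` is replaced by a
clique of order `t v`, with complete joins along edges of `G`. -/
def lexProd (G : SimpleGraph V) (t : V → ℕ) : SimpleGraph (Σ v : V, Fin (t v)) :=
  SimpleGraph.fromRel fun a b => a.1 = b.1 ∨ G.Adj a.1 b.1

/-- Index conversion identifying the vertices `v_1, …, v_{⌈k/2⌉}, w_1, …, w_{⌊k/2⌋}`
of `G_k` with `Fin k` (in this order). -/
def toIdx {k : ℕ} : Fin ((k + 1) / 2) ⊕ Fin (k / 2) → Fin k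
  | Sum.inl i => ⟨(i : ℕ), by have := i.isLt; omega⟩
  | Sum.inr j => ⟨(k + 1) / 2 + (j : ℕ), by have := j.isLt; omega⟩

/-- `B_k(n_1, …, n_k) = G_k[K_{n_1}, …, K_{n_k}]`. -/
def bGraph (k : ℕ) (nn : Fin k → ℕ) :
    SimpleGraph (Σ v : Fin ((k + 1) / 2) ⊕ Fin (k / 2), Fin (nn (toIdx v))) :=
  lexProd (oboudi k) fun v => nn (toIdx v)

/-- Membership in `𝓓* = {B_k(n_1,…,n_k) ∈ 𝓑_k^{00}(n) : 4 ≤ k ≤ 14, n ≤ 14}` (up to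
isomorphism). -/
def memDstar {n : ℕ} (G : SimpleGraph (Fin n)) : Prop :=
  ∃ (k : ℕ) (nn : Fin k → ℕ), 4 ≤ k ∧ k ≤ 14 ∧ (∀ i, 1 ≤ nn i) ∧ (∑ i, nn i) ≤ 14 ∧
    lam (bGraph k nn) 3 = 0 ∧ lam (bGraph k nn) 4 = 0 ∧ Nonempty (G ≃g bGraph k nn)

/-- The degree of a vertex. -/
noncomputable def deg [Finite V] (G : SimpleGraph V) (v : V) : ℕ :=
  Nat.card (G.neighborSet v)

/-- `v` is a vertex of minimum degree. -/
def IsMinDegVertex [Finite V] (G : SimpleGraph V) (v : V) : Prop :=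
  ∀ w, deg G v ≤ deg G w

/-- The set `Y = V(G) ∖ N[v]`. -/
def Yset (G : SimpleGraph V) (v : V) : Set V :=
  (G.neighborSet v ∪ {v})ᶜ

/-- `G` is `X`-complete with respect to `v`: `G[Y] ≅ K_{n-t-1}` with `n-t-1 ≥ 2`
and `G[X]` is complete, where `X = N(v)`, `Y = V(G) ∖ N[v]`. -/
def IsXComplete [Finite V] (G : SimpleGraph V) (v : V) : Prop :=
  2 ≤ (Yset G v).ncard ∧ (Yset G v).Pairwise G.Adj ∧ (G.neighborSet v).Pairwise G.Adj

/-- An `X`-complete graph is reduced when the traces on `Y` of the neighbourhoods of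
vertices of `X` form a chain. -/
def IsReduced (G : SimpleGraph V) (v : V) : Prop :=
  ∀ x ∈ G.neighborSet v, ∀ x' ∈ G.neighborSet v,
    G.neighborSet x ∩ Yset G v ⊆ G.neighborSet x' ∩ Yset G v ∨
    G.neighborSet x' ∩ Yset G v ⊆ G.neighborSet x ∩ Yset G v

/-! ### Words, transfer action and quadratic form

A letter `true` is a vertex of the first clique, `false` a vertex of the second one. In a word,
two letters at positions `i < j` are non-adjacent exactly when they are `true, false`. -/

/-- Transfer action of a word on pairs `(α, β)`. -/
def act : List Bool → ℝ → ℝ → ℝ × ℝ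
  | [], α, β => (α, β)
  | true :: w, α, β => act w α (β - α)
  | false :: w, α, β => act w (α + β) β

/-- Sum of `true` coefficients, sum of `false` coefficients, value of the quadratic form. -/
def st : List (Bool × ℝ) → ℝ × ℝ × ℝ
  | [] => (0, 0, 0)
  | (true, x) :: D => ((st D).1 + x, (st D).2.1, (st D).2.2 + 2 * x * (st D).1)
  | (false, x) :: D => ((st D).1, (st D).2.1 + x, (st D).2.2 + 2 * x * ((st D).1 + (st D).2.1))

/-- Evaluate a decorated word. -/
def evalD (D : List (Bool × (Fin 3 → ℝ))) (c : Fin 3 → ℝ) : List (Bool × ℝ) :=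
  D.map fun p => (p.1, p.2 ⬝ᵥ c)

/-- The form of the word is positive definite on some three-dimensional space. -/
def Pos3 (w : List Bool) : Prop :=
  ∃ D : List (Bool × (Fin 3 → ℝ)), D.map Prod.fst = w ∧
    ∀ c : Fin 3 → ℝ, c ≠ 0 → 0 < (st (evalD D c)).2.2

/-- Braid equivalence of positive words. -/
inductive Br : List Bool → List Bool → Prop
  | refl (w) : Br w w
  | trans {a b c} : Br a b → Br b c → Br a c
  | move (u v : List Bool) (x : Bool) : Br (u ++ x :: (!x) :: x :: v) (u ++ (!x) :: x :: (!x) :: v)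

lemma Br.length {a b : List Bool} (h : Br a b) : a.length = b.length := by
  induction h with
  | refl => rfl
  | trans _ _ h1 h2 => exact h1.trans h2
  | move => simp

lemma Br.append_left {a b : List Bool} (h : Br a b) (p : List Bool) : Br (p ++ a) (p ++ b) := by
  induction h with
  | refl => exact Br.refl _
  | trans _ _ h1 h2 => exact h1.trans h2
  | move u v x => simpa using Br.move (p ++ u) v x

lemma act_append (u v : List Bool) (α β : ℝ) :
    act (u ++ v) α β = act v (act u α β).1 (act u α β).2 := by
  induction u generalizing α β with
  | nil => rfl
  | cons x u ih => cases x <;> simp [act, ih]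

lemma Br.act_eq {a b : List Bool} (h : Br a b) (α β : ℝ) : act a α β = act b α β := by
  induction h with
  | refl => rfl
  | trans _ _ h1 h2 => exact h1.trans h2
  | move u v x =>
    rw [act_append, act_append]
    cases x <;> simp [act]

lemma st_context (u a b : List (Bool × ℝ)) (h : st a = st b) : st (u ++ a) = st (u ++ b) := by
  induction u with
  | nil => simpa
  | cons x u ih =>
    obtain ⟨c, x⟩ := x
    cases c <;> simp [st, ih]

lemma Pos3.br {a b : List Bool} (h : Br a b) : Pos3 b → Pos3 a := by
  induction h with
  | refl => exact id
  | trans _ _ h1 h2 => exact fun h => h1 (h2 h)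
  | move u v x =>
    rintro ⟨D, hD, hpos⟩
    obtain ⟨D1, D2, rfl, h1, h2⟩ := List.map_eq_append_iff.1 hD
    obtain ⟨⟨y1, e1⟩, D3, rfl, hy1, h3⟩ := List.map_eq_cons_iff.1 h2
    obtain ⟨⟨y2, e2⟩, D4, rfl, hy2, h4⟩ := List.map_eq_cons_iff.1 h3
    obtain ⟨⟨y3, e3⟩, D5, rfl, hy3, h5⟩ := List.map_eq_cons_iff.1 h4
    simp only at hy1 hy2 hy3
    subst hy1 hy2 hy3
    cases y2
    · refine ⟨D1 ++ (false, e3) :: (true, e1 + e3) :: (false, e2 - e3) :: D5, by simp [h1, h5], ?_⟩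
      intro c hc
      have := hpos c hc
      convert this using 3
      simp only [evalD, List.map_append, List.map_cons]
      apply st_context
      simp [st, sub_dotProduct, add_dotProduct]
      refine ⟨by ring, by ring, by ring⟩
    · refine ⟨D1 ++ (true, e2 - e1) :: (false, e3 + e1) :: (true, e1) :: D5, by simp [h1, h5], ?_⟩
      intro c hc
      have := hpos c hc
      convert this using 3
      simp only [evalD, List.map_append, List.map_cons]
      apply st_context
      simp [st, sub_dotProduct, add_dotProduct]
      refine ⟨by ring, by ring⟩

lemma Pos3.append {a : List Bool} (h : Pos3 a) (b : List Bool) : Pos3 (a ++ b) := by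
  obtain ⟨D, hD, hpos⟩ := h
  refine ⟨D ++ b.map (fun x => (x, 0)), by simp [hD, Function.comp_def], fun c hc => ?_⟩
  have := hpos c hc
  convert this using 3
  have h0 : st (evalD (b.map (fun x => (x, 0))) c) = st [] := by
    induction b with
    | nil => rfl
    | cons x b ih => cases x <;> simpa [evalD, st] using ih
  have := st_context (evalD D c) _ _ h0
  simpa [evalD] using this

/-- The half twist, repeated. -/
def tw : ℕ → List Bool
  | 0 => []
  | m + 1 => true :: false :: true :: tw m

lemma tw_length (m : ℕ) : (tw m).length = 3 * m := by
  induction m with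
  | zero => rfl
  | succ m ih => simp [tw, ih]; ring

lemma tw_add (m k : ℕ) : tw (m + k) = tw m ++ tw k := by
  induction m with
  | zero => simp [tw]
  | succ m ih => rw [Nat.succ_add]; simp [tw, ih]

lemma pos3_tw5 : Pos3 (tw 5) := by
  refine ⟨[(true, ![1, -2, -1]), (false, ![2, 1, -1]), (true, ![2, -2, -2]),
    (true, ![2, -2, -2]), (false, ![2, 2, 2]), (true, ![2, -1, 0]),
    (true, ![2, -1, 0]), (false, ![1, 2, 2]), (true, ![2, -1, 2]),
    (true, ![2, -1, 2]), (false, ![1, 3, -2]), (true, ![2, 0, 0]),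
    (true, ![2, 0, 0]), (false, ![1, 3, -2]), (true, ![2, 1, -2])], rfl, ?_⟩
  intro c hc
  have key : ∀ x y z : ℝ, ¬ (x = 0 ∧ y = 0 ∧ z = 0) →
      0 < 526 * x^2 + 140 * y^2 + 8 * z^2 - 42 * x * y - 94 * x * z + 12 * y * z := by
    intro x y z h
    by_contra hn
    push Not at hn
    have h1 : 526 * x^2 + 140 * y^2 + 8 * z^2 - 42 * x * y - 94 * x * z + 12 * y * z
      = 8 * (z - 47/8 * x + 3/4 * y)^2 + (526 - 47^2/8) * (x + 57/4/(526 - 47^2/8) * y)^2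
        + (140 - 9/2 - (57/4)^2/(526 - 47^2/8)) * y^2 := by ring
    have hy : y^2 ≤ 0 := by
      nlinarith [sq_nonneg (z - 47/8 * x + 3/4 * y), sq_nonneg (x + 57/4/(526 - 47^2/8) * y)]
    have hy0 : y = 0 := by nlinarith [pow_eq_zero_iff (two_ne_zero) (a := y), le_antisymm hy (sq_nonneg y)]
    subst hy0
    have hx : x^2 ≤ 0 := by nlinarith [sq_nonneg (z - 47/8 * x)]
    have hx0 : x = 0 := pow_eq_zero_iff (two_ne_zero) |>.1 (le_antisymm hx (sq_nonneg x))
    subst hx0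
    have hz : z^2 ≤ 0 := by nlinarith
    have hz0 : z = 0 := pow_eq_zero_iff (two_ne_zero) |>.1 (le_antisymm hz (sq_nonneg z))
    exact h ⟨rfl, rfl, hz0⟩
  have := key (c 0) (c 1) (c 2) (by
    rintro ⟨h0, h1, h2⟩
    apply hc
    ext i
    fin_cases i <;> simp [h0, h1, h2])
  convert this using 1
  simp [evalD, st, dotProduct, Fin.sum_univ_three]
  ring

/-- No braid move is applicable. -/
def NoBraid (w : List Bool) : Prop := ∀ u v x, w ≠ u ++ x :: (!x) :: x :: v

lemma NoBraid.tail {x : Bool} {w : List Bool} (h : NoBraid (x :: w)) : NoBraid w := by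
  rintro u v y rfl
  exact h (x :: u) v y rfl

lemma NoBraid.not {w : List Bool} (h : NoBraid w) : NoBraid (w.map (! ·)) := by
  intro u v x hw
  have h2 := congrArg (List.map (! ·)) hw
  simp only [List.map_map, List.map_append, List.map_cons] at h2
  apply h (u.map (! ·)) (v.map (! ·)) (!x)
  rw [← h2]
  simp [Function.comp_def]

lemma br_swap (x : Bool) (v : List Bool) :
    Br (x :: true :: false :: true :: v) (true :: false :: true :: (!x) :: v) := by
  cases x
  · exact Br.move [] (true :: v) false
  · exact Br.move [true] v true

lemma br_pull (u v : List Bool) :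
    Br (u ++ true :: false :: true :: v) (true :: false :: true :: (u.map (! ·) ++ v)) := by
  induction u with
  | nil => exact Br.refl _
  | cons x u ih => exact (ih.append_left [x]).trans (br_swap x _)

lemma normal_form (n : ℕ) : ∀ w : List Bool, w.length = n →
    ∃ m r, Br w (tw m ++ r) ∧ NoBraid r := by
  induction n using Nat.strong_induction_on with
  | _ n ih =>
    intro w hw
    by_cases hb : NoBraid w
    · exact ⟨0, w, Br.refl _, hb⟩
    · simp only [NoBraid, not_forall, not_not] at hb
      obtain ⟨u, v, x, rfl⟩ := hb
      have h1 : Br (u ++ x :: (!x) :: x :: v) (u ++ true :: false :: true :: v) := by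
        cases x
        · exact Br.move u v false
        · exact Br.refl _
      have h2 := h1.trans (br_pull u v)
      obtain ⟨m, r, h3, h4⟩ := ih (u.map (! ·) ++ v).length
        (by simp at hw ⊢; omega) _ rfl
      exact ⟨m + 1, r, h2.trans (h3.append_left [true, false, true]), h4⟩

lemma act_not (r : List Bool) (α β : ℝ) :
    act (r.map (! ·)) β (-α) = ((act r α β).2, -(act r α β).1) := by
  induction r generalizing α β with
  | nil => rfl
  | cons x r ih =>
    cases x
    · have := ih (α + β) β
      simp only [List.map_cons, Bool.not_false, act]
      rw [← this]; congr 1; ring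
    · have := ih α (β - α)
      simp only [List.map_cons, Bool.not_true, act]
      rw [← this]; congr 1

/-- The image has a coordinate of absolute value at least two. -/
def Big (z : ℝ × ℝ) : Prop := 2 ≤ |z.1| ∨ 2 ≤ |z.2|

lemma big_of_cone (n : ℕ) : ∀ (r : List Bool), r.length = n → ∀ α β : ℝ, 1 ≤ β → β + 1 ≤ α →
    NoBraid (false :: false :: r) → Big (act r α β) := by
  induction n using Nat.strong_induction_on with
  | _ n ih =>
    intro r hr α β hβ hα hb
    match r, hr, hb with
    | [], _, _ => left; simp only [act]; rw [abs_of_nonneg] <;> linarith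
    | false :: r', hr, hb =>
      exact ih r'.length (by simp at hr; omega) r' rfl _ _ hβ (by linarith) hb.tail
    | [true], _, _ => left; simp only [act]; rw [abs_of_nonneg] <;> linarith
    | true :: false :: r', hr, hb => exact absurd rfl (hb [false] r' false)
    | true :: true :: r', hr, hb =>
      have h := ih (r'.map (! ·)).length (by simp at hr ⊢; omega) (r'.map (! ·)) rfl
        (2 * α - β) α (by linarith) (by linarith) (by simpa using hb.tail.tail.not)
      have h2 := act_not (r'.map (! ·)) (2 * α - β) α
      simp only [List.map_map, Function.comp_def, Bool.not_not, List.map_id'] at h2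
      simp only [act]
      rw [show β - α - α = -(2 * α - β) by ring, h2]
      rcases h with h | h
      · right; simpa using h
      · left; exact h

lemma act_rep_true (n : ℕ) (α β : ℝ) : act (List.replicate n true) α β = (α, β - n * α) := by
  induction n generalizing α β with
  | zero => simp [act]
  | succ n ih => simp [List.replicate_succ, act, ih]; ring

lemma act_rep_false (n : ℕ) (α β : ℝ) : act (List.replicate n false) α β = (α + n * β, β) := by
  induction n generalizing α β with
  | zero => simp [act]
  | succ n ih => simp [List.replicate_succ, act, ih]; ring

lemma split_run (x : Bool) (r : List Bool) :
    ∃ n r', r = List.replicate n x ++ r' ∧ (r' = [] ∨ ∃ r'', r' = (!x) :: r'') := by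
  induction r with
  | nil => exact ⟨0, [], rfl, Or.inl rfl⟩
  | cons y r ih =>
    obtain ⟨n, r', h, h'⟩ := ih
    by_cases hy : y = x
    · subst hy
      exact ⟨n + 1, r', by simp [h, List.replicate_succ], h'⟩
    · exact ⟨0, y :: r, rfl, Or.inr ⟨r, by cases x <;> cases y <;> simp_all⟩⟩

lemma NoBraid.suffix {u w : List Bool} (h : NoBraid (u ++ w)) : NoBraid w := by
  induction u with
  | nil => exact h
  | cons x u ih => exact ih h.tail

lemma act_tw (m : ℕ) (r : List Bool) :
    ((∀ α β, act (tw m ++ r) α β = act r α β) ∨ (∀ α β, act (tw m ++ r) α β = act r β (-α)) ∨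
    (∀ α β, act (tw m ++ r) α β = act r (-α) (-β)) ∨
    (∀ α β, act (tw m ++ r) α β = act r (-β) α)) := by
  induction m with
  | zero => left; simp [tw]
  | succ m ih =>
    have h : ∀ α β, act (tw (m + 1) ++ r) α β = act (tw m ++ r) β (-α) := by
      intro α β
      simp only [tw, List.cons_append, act]
      congr 1 <;> ring
    rcases ih with ih | ih | ih | ih
    · right; left; intro α β; rw [h, ih]
    · right; right; left; intro α β; rw [h, ih]
    · right; right; right; intro α β; rw [h, ih]; simp
    · left; intro α β; rw [h, ih]; simp

lemma short_of_act (r : List Bool) (hb : NoBraid r)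
    (h : (∀ α β, act r α β = (β, β - α)) ∨ (∀ α β, act r α β = (α, α + β)) ∨
      (∀ α β, act r α β = (-β, α - β)) ∨ (∀ α β, act r α β = (-α, -α - β))) :
    r.length ≤ 2 := by
  have hnb1 : ¬ Big (act r 1 0) := by
    rcases h with h | h | h | h <;> rw [h] <;> norm_num [Big]
  have hnb2 : ¬ Big (act r 0 1) := by
    rcases h with h | h | h | h <;> rw [h] <;> norm_num [Big]
  match r with
  | [] => simp
  | true :: r =>
    obtain ⟨n, r', rfl, h'⟩ := split_run true r
    rcases h' with rfl | ⟨r'', rfl⟩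
    · exfalso
      have e := act_rep_true (n + 1)
      simp only [List.replicate_succ] at e
      simp only [List.append_nil] at h
      have hn : (0 : ℝ) ≤ n := n.cast_nonneg
      rcases h with h | h | h | h
      all_goals
        have h1 := (e 1 0).symm.trans (h 1 0)
        simp at h1
        try linarith
    · have e : ∀ α β s, act (true :: (List.replicate n true ++ s)) α β
          = act s α (β - (n + 1) * α) := by
        intro α β s
        have e := act_rep_true (n + 1) α β
        rw [← List.cons_append, ← List.replicate_succ, act_append, e]
        simp
      match r'' with
      | [] =>
        have h1 := e 1 0 [!true]
        have h2 := e 0 1 [!true]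
        simp only [List.cons_append, act, Bool.not_true] at h1 h2 h
        have hn : (0 : ℝ) ≤ n := n.cast_nonneg
        rcases h with h | h | h | h
        all_goals
          have h3 := h1.symm.trans (h 1 0)
          have h4 := h2.symm.trans (h 0 1)
          simp at h3 h4
          try linarith
        have : n = 0 := by exact_mod_cast h3
        simp [this]
      | true :: s =>
        exfalso
        have h3 : true :: (List.replicate n true ++ (!true) :: true :: s)
            = List.replicate n true ++ true :: (!true) :: true :: s := by
          rw [← List.cons_append, ← List.replicate_succ, List.replicate_succ']; simp
        exact hb _ _ _ h3
      | false :: s =>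
        exfalso
        apply hnb2
        rw [e]
        simp only [Bool.not_true, act]
        refine big_of_cone _ s rfl _ _ ?_ ?_ ?_
        · norm_num
        · norm_num
        · exact (NoBraid.tail hb).suffix
  | false :: r =>
    exfalso
    obtain ⟨n, r', rfl, h'⟩ := split_run false r
    rcases h' with rfl | ⟨r'', rfl⟩
    · have e := act_rep_false (n + 1)
      simp only [List.replicate_succ] at e
      simp only [List.append_nil] at h
      have hn : (0 : ℝ) ≤ n := n.cast_nonneg
      rcases h with h | h | h | h
      all_goals
        have h1 := (e 1 0).symm.trans (h 1 0)
        simp at h1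
        try linarith
    · have e : ∀ α β s, act (false :: (List.replicate n false ++ s)) α β
          = act s (α + (n + 1) * β) β := by
        intro α β s
        have e := act_rep_false (n + 1) α β
        rw [← List.cons_append, ← List.replicate_succ, act_append, e]
        simp
      match r'' with
      | [] =>
        have h1 := e 1 0 [!false]
        simp only [List.cons_append, act, Bool.not_false] at h1 h
        rcases h with h | h | h | h
        all_goals
          have h3 := h1.symm.trans (h 1 0)
          simp at h3
          try linarith
      | false :: s =>
        have h3 : false :: (List.replicate n false ++ (!false) :: false :: s)
            = List.replicate n false ++ false :: (!false) :: false :: s := by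
          rw [← List.cons_append, ← List.replicate_succ, List.replicate_succ']; simp
        exact hb _ _ _ h3
      | true :: s =>
        apply hnb1
        rw [e]
        simp only [Bool.not_false, act]
        have hs : NoBraid (true :: true :: s) := (NoBraid.tail hb).suffix
        have h4 := big_of_cone _ (s.map (! ·)) rfl 2 1 (by norm_num) (by norm_num)
          (by simpa using hs.not)
        have h2 := act_not (s.map (! ·)) 2 1
        simp only [List.map_map, Function.comp_def, Bool.not_not, List.map_id'] at h2
        norm_num
        rw [h2]
        rcases h4 with h | h
        · right; simpa using h
        · left; exact h

/-- Main combinatorial statement. -/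
lemma pos3_of_act (w : List Bool) (hw : 15 ≤ w.length)
    (h : ∀ α β, act w α β = (β, β - α)) : Pos3 w := by
  obtain ⟨m, r, hbr, hnb⟩ := normal_form _ w rfl
  have hlen := hbr.length
  rw [List.length_append, tw_length] at hlen
  have h' : ∀ α β, act (tw m ++ r) α β = (β, β - α) := fun α β => by rw [← hbr.act_eq, h]
  have hr : r.length ≤ 2 := by
    apply short_of_act r hnb
    rcases act_tw m r with e | e | e | e
    · left; intro α β; rw [← e, h']
    · right; left; intro α β
      have := (e (-β) α).symm.trans (h' (-β) α)
      rw [neg_neg] at this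
      rw [this]; simp
    · right; right; left; intro α β
      have := (e (-α) (-β)).symm.trans (h' (-α) (-β))
      rw [neg_neg, neg_neg] at this
      rw [this]; ext <;> simp; ring
    · right; right; right; intro α β
      have := (e β (-α)).symm.trans (h' β (-α))
      rw [neg_neg] at this
      rw [this]
  obtain ⟨k, rfl⟩ : ∃ k, m = 5 + k := ⟨m - 5, by omega⟩
  apply Pos3.br hbr
  rw [tw_add, List.append_assoc]
  exact pos3_tw5.append _

/-! ### From graphs to words -/

/-- The list is an admissible ordering of the vertices. -/
def Compat (G : SimpleGraph V) (c : V → Bool) (l : List V) : Prop :=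
  l.Pairwise fun u u' => (G.Adj u u' ↔ ¬ (c u = true ∧ c u' = false))

/-- Sum of the `true` values. -/
def sv (c : V → Bool) (x : V → ℝ) (l : List V) : ℝ :=
  (l.map fun u => if c u = true then x u else 0).sum

/-- Sum of the `false` values. -/
def sw (c : V → Bool) (x : V → ℝ) (l : List V) : ℝ :=
  (l.map fun u => if c u = false then x u else 0).sum

lemma sv_cons (c : V → Bool) (x : V → ℝ) (u : V) (l : List V) :
    sv c x (u :: l) = (if c u = true then x u else 0) + sv c x l := by simp [sv]

lemma sw_cons (c : V → Bool) (x : V → ℝ) (u : V) (l : List V) :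
    sw c x (u :: l) = (if c u = false then x u else 0) + sw c x l := by simp [sw]

lemma sv_append (c : V → Bool) (x : V → ℝ) (p l : List V) :
    sv c x (p ++ l) = sv c x p + sv c x l := by simp [sv]

lemma sw_append (c : V → Bool) (x : V → ℝ) (p l : List V) :
    sw c x (p ++ l) = sw c x p + sw c x l := by simp [sw]

lemma sv_lin (c : V → Bool) (x y : V → ℝ) (a b : ℝ) (l : List V) :
    sv c (a • x + b • y) l = a * sv c x l + b * sv c y l := by
  induction l with
  | nil => simp [sv]
  | cons u l ih => rw [sv_cons, sv_cons, sv_cons, ih]; split_ifs <;> simp <;> ring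

lemma sw_lin (c : V → Bool) (x y : V → ℝ) (a b : ℝ) (l : List V) :
    sw c (a • x + b • y) l = a * sw c x l + b * sw c y l := by
  induction l with
  | nil => simp [sw]
  | cons u l ih => rw [sw_cons, sw_cons, sw_cons, ih]; split_ifs <;> simp <;> ring

lemma act_lin (w : List Bool) (a b α β α' β' : ℝ) :
    act w (a * α + b * α') (a * β + b * β') =
      (a * (act w α β).1 + b * (act w α' β').1, a * (act w α β).2 + b * (act w α' β').2) := by
  induction w generalizing α β α' β' with
  | nil => rfl
  | cons x w ih =>
    cases x
    · simp only [act]; rw [← ih]; congr 1; ring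
    · simp only [act]; rw [← ih]; congr 1; ring

section
variable [Fintype V] [DecidableEq V]

lemma adjMat_of_adj {G : SimpleGraph V} {u v : V} (h : G.Adj u v) : adjMat G u v = 1 := by
  simp [adjMat, h]

lemma adjMat_of_not_adj {G : SimpleGraph V} {u v : V} (h : ¬ G.Adj u v) : adjMat G u v = 0 := by
  simp [adjMat, h]

lemma adjMat_symm (G : SimpleGraph V) (u v : V) : adjMat G u v = adjMat G v u := by
  by_cases h : G.Adj u v
  · rw [adjMat_of_adj h, adjMat_of_adj h.symm]
  · rw [adjMat_of_not_adj h, adjMat_of_not_adj (fun h' => h h'.symm)]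

lemma row_after (G : SimpleGraph V) (c : V → Bool) (x : V → ℝ) (u : V) (l : List V)
    (h : ∀ u' ∈ l, (G.Adj u u' ↔ ¬ (c u = true ∧ c u' = false))) :
    (l.map fun u' => adjMat G u u' * x u').sum =
      if c u = true then sv c x l else sv c x l + sw c x l := by
  induction l with
  | nil => simp [sv, sw]
  | cons a l ih =>
    have h1 := ih (fun u' hu' => h u' (List.mem_cons_of_mem _ hu'))
    have h2 := h a List.mem_cons_self
    rw [List.map_cons, List.sum_cons, h1, sv_cons, sw_cons]
    cases hu : c u <;> cases ha : c a <;> simp [hu, ha] at h2 ⊢ <;>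
      first
      | (rw [adjMat_of_adj h2]; ring)
      | (rw [adjMat_of_not_adj h2]; simp)

lemma row_before (G : SimpleGraph V) (c : V → Bool) (x : V → ℝ) (u : V) (l : List V)
    (h : ∀ u' ∈ l, (G.Adj u' u ↔ ¬ (c u' = true ∧ c u = false))) :
    (l.map fun u' => adjMat G u u' * x u').sum =
      if c u = true then sv c x l + sw c x l else sw c x l := by
  induction l with
  | nil => simp [sv, sw]
  | cons a l ih =>
    have h1 := ih (fun u' hu' => h u' (List.mem_cons_of_mem _ hu'))
    have h2 := h a List.mem_cons_self
    rw [List.map_cons, List.sum_cons, h1, sv_cons, sw_cons, adjMat_symm]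
    cases hu : c u <;> cases ha : c a <;> simp [hu, ha] at h2 ⊢ <;>
      first
      | (rw [adjMat_of_adj h2]; ring)
      | (rw [adjMat_of_not_adj h2]; simp)

lemma st_fst (c : V → Bool) (x : V → ℝ) (l : List V) :
    (st (l.map fun u => (c u, x u))).1 = sv c x l ∧
    (st (l.map fun u => (c u, x u))).2.1 = sw c x l := by
  induction l with
  | nil => simp [st, sv, sw]
  | cons u l ih =>
    rw [sv_cons, sw_cons, ← ih.1, ← ih.2]
    cases hu : c u <;> simp [st, hu, add_comm]

lemma st_quad (G : SimpleGraph V) (c : V → Bool) (x : V → ℝ) (l : List V) (h : Compat G c l) :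
    (st (l.map fun u => (c u, x u))).2.2 =
      (l.map fun u => x u * (l.map fun u' => adjMat G u u' * x u').sum).sum := by
  induction l with
  | nil => simp [st]
  | cons u l ih =>
    obtain ⟨h1, h2⟩ := List.pairwise_cons.1 h
    have ih := ih h2
    have hr := row_after G c x u l h1
    obtain ⟨f1, f2⟩ := st_fst c x l
    have h0 : adjMat G u u = 0 := adjMat_of_not_adj (G.irrefl)
    have hs : (l.map fun a => x a * (adjMat G a u * x u)).sum
        = x u * (l.map fun u' => adjMat G u u' * x u').sum := by
      rw [← List.sum_map_mul_left]
      congr 1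
      apply List.map_congr_left
      intro a _
      rw [adjMat_symm G a u]; ring
    simp only [List.map_cons, List.sum_cons, h0, mul_add, List.sum_map_add, hs]
    rw [← ih, hr]
    cases hu : c u <;> simp [st, hu, f1, f2] <;> ring

lemma null_act (G : SimpleGraph V) (c : V → Bool) (x : V → ℝ) (l : List V) :
    ∀ (p : List V), Compat G c (p ++ l) →
    (∀ u, ((p ++ l).map fun u' => adjMat G u u' * x u').sum = 0) →
    act (l.map c) (sv c x (p ++ l) + sw c x p) (sw c x (p ++ l) + sv c x l) =
      (sv c x (p ++ l) + sw c x (p ++ l), sw c x (p ++ l)) ∧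
    (sv c x (p ++ l) + sw c x p = 0 → sw c x (p ++ l) + sv c x l = 0 → ∀ u ∈ l, x u = 0) := by
  induction l with
  | nil => intro p _ _; simp [act, sv]
  | cons u l ih =>
    intro p hc hx
    have e : p ++ u :: l = (p ++ [u]) ++ l := by simp
    obtain ⟨i1, i2⟩ := ih (p ++ [u]) (e ▸ hc) (e ▸ hx)
    rw [← e] at i1 i2
    obtain ⟨c1, c2, c3⟩ := List.pairwise_append.1 hc
    have ra := row_after G c x u l (List.pairwise_cons.1 c2).1
    have rb := row_before G c x u p (fun a ha => c3 a ha u List.mem_cons_self)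
    have hu := hx u
    have h0 : adjMat G u u = 0 := adjMat_of_not_adj (G.irrefl)
    rw [List.map_append, List.map_cons, List.sum_append, List.sum_cons, ra, rb, h0] at hu
    have n1 : sw c x [u] = if c u = false then x u else 0 := by simp [sw]
    rw [sw_append c x p [u], n1] at i1 i2
    cases hcu : c u
    · simp only [hcu, if_true, if_false, Bool.false_eq_true] at hu i1 i2
      have hxu : x u = sw c x (p ++ u :: l) + sv c x (u :: l) := by
        simp only [sw_append, sw_cons, sv_cons, hcu, if_true, if_false, Bool.false_eq_true]
        linarith
      have hv : sv c x (u :: l) = sv c x l := by simp [sv_cons, hcu]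
      rw [List.map_cons, hcu]
      simp only [act]
      constructor
      · rw [← i1]
        congr 1
        · linarith
        · rw [hv]
      · intro a1 a2 z hz
        rcases List.mem_cons.1 hz with rfl | hz
        · linarith
        · exact i2 (by linarith) (by linarith) z hz
    · simp only [hcu, if_true, if_false, Bool.true_eq_false] at hu i1 i2
      have hxu : x u = sv c x (p ++ u :: l) + sw c x p := by
        simp only [sv_append, sv_cons, hcu, if_true]
        linarith
      have hv : sv c x (u :: l) = x u + sv c x l := by simp [sv_cons, hcu]
      rw [List.map_cons, hcu]
      simp only [act]
      constructor
      · rw [← i1]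
        congr 1
        · linarith
        · rw [hv]; linarith
      · intro a1 a2 z hz
        rcases List.mem_cons.1 hz with rfl | hz
        · linarith
        · exact i2 (by linarith) (by linarith) z hz

lemma act_of_null (G : SimpleGraph V) (c : V → Bool) (l : List V) (hl : ∀ u, u ∈ l)
    (hc : Compat G c l) (x y : V → ℝ)
    (hx : ∀ u, (l.map fun u' => adjMat G u u' * x u').sum = 0)
    (hy : ∀ u, (l.map fun u' => adjMat G u u' * y u').sum = 0)
    (hind : ∀ a b : ℝ, a • x + b • y = 0 → a = 0 ∧ b = 0) :
    ∀ α β, act (l.map c) α β = (β, β - α) := by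
  have ax := (null_act G c x l [] hc hx).1
  have ay := (null_act G c y l [] hc hy).1
  have hxy : ∀ a b : ℝ, a * sv c x l + b * sv c y l = 0 → a * sw c x l + b * sw c y l = 0 →
      a = 0 ∧ b = 0 := by
    intro a b h1 h2
    apply hind
    have hz : ∀ u, (l.map fun u' => adjMat G u u' * (a • x + b • y) u').sum = 0 := by
      intro u
      have : (fun u' => adjMat G u u' * (a • x + b • y) u') =
          fun u' => a * (adjMat G u u' * x u') + b * (adjMat G u u' * y u') := by
        ext u'; simp; ring
      rw [this, List.sum_map_add, List.sum_map_mul_left, List.sum_map_mul_left, hx, hy]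
      simp
    have := (null_act G c (a • x + b • y) l [] hc hz).2
    simp only [List.nil_append, sv_lin, sw_lin] at this
    ext u
    refine this ?_ ?_ u (hl u)
    · rw [h1]; simp [sw]
    · rw [h1, h2]; simp
  simp only [List.nil_append] at ax ay
  have n0 : ∀ x, sw c x [] = 0 := fun x => by simp [sw]
  rw [n0] at ax ay
  set p := sv c x l
  set q := sw c x l
  set p' := sv c y l
  set q' := sw c y l
  have hD : p * q' - p' * q ≠ 0 := by
    intro hD
    have h1 := hxy p' (-p) (by ring) (by linarith)
    have h2 := hxy q' (-q) (by linarith) (by ring)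
    have e1 : p' = 0 := h1.1
    have e2 : p = 0 := by linarith [h1.2]
    have e3 : q' = 0 := h2.1
    have e4 : q = 0 := by linarith [h2.2]
    have := hxy 1 0 (by simp [e1, e2]) (by simp [e3, e4])
    exact one_ne_zero this.1
  intro α β
  obtain ⟨a, b, h1, h2⟩ : ∃ a b, a * p + b * p' = α ∧ a * q + b * q' = β - α := by
    refine ⟨(α * q' - (β - α) * p') / (p * q' - p' * q),
      ((β - α) * p - α * q) / (p * q' - p' * q), ?_, ?_⟩
    · rw [div_mul_eq_mul_div, div_mul_eq_mul_div, ← add_div, div_eq_iff hD]; ring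
    · rw [div_mul_eq_mul_div, div_mul_eq_mul_div, ← add_div, div_eq_iff hD]; ring
  have := act_lin (l.map c) a b (p + 0) (q + p) (p' + 0) (q' + p')
  rw [ax, ay, show a * (p + 0) + b * (p' + 0) = α by linarith,
    show a * (q + p) + b * (q' + p') = β by linarith] at this
  rw [this]
  ext <;> simp <;> linarith

lemma lift_deco {E : Type*} [Inhabited E] (c : V → Bool) (l : List V) (hl : l.Nodup) :
    ∀ D : List (Bool × E), D.map Prod.fst = l.map c →
    ∃ φ : V → E, D = l.map fun u => (c u, φ u) := by
  induction l with
  | nil => intro D hD; exact ⟨fun _ => default, by simpa using hD⟩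
  | cons u l ih =>
    intro D hD
    obtain ⟨⟨b, e⟩, D', rfl, h1, h2⟩ := List.map_eq_cons_iff.1 hD
    obtain ⟨hu, hl'⟩ := List.nodup_cons.1 hl
    obtain ⟨φ, hφ⟩ := ih hl' D' h2
    refine ⟨Function.update φ u e, ?_⟩
    simp only at h1
    rw [List.map_cons, hφ, h1]
    simp only [Function.update_self, List.cons.injEq, true_and]
    apply List.map_congr_left
    intro a ha
    rw [Function.update_of_ne]
    rintro rfl
    exact hu ha

lemma quad_nonpos (G : SimpleGraph V) (x : V → ℝ)
    (h : ∀ i, 0 < eigs G i →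
      (((adjMat_isHermitian G).eigenvectorBasis i : EuclideanSpace ℝ V) : V → ℝ) ⬝ᵥ x = 0) :
    x ⬝ᵥ (adjMat G *ᵥ x) ≤ 0 := by
  set b := (adjMat_isHermitian G).eigenvectorBasis with hb
  have h1 := b.sum_inner_mul_inner (WithLp.toLp 2 x) (WithLp.toLp 2 (adjMat G *ᵥ x))
  simp only [EuclideanSpace.inner_eq_star_dotProduct, star_trivial] at h1
  rw [dotProduct_comm, ← h1]
  apply Finset.sum_nonpos
  intro i _
  have hsym : (adjMat G)ᵀ = adjMat G := by
    ext u v; exact adjMat_symm G v u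
  have h2 : (adjMat G *ᵥ x) ⬝ᵥ (b i : V → ℝ) = eigs G i * (x ⬝ᵥ (b i : V → ℝ)) := by
    have h3 := (adjMat_isHermitian G).mulVec_eigenvectorBasis i
    rw [dotProduct_comm, dotProduct_mulVec, ← mulVec_transpose, hsym, h3, smul_dotProduct,
      dotProduct_comm]
    rfl
  rw [h2]
  by_cases hp : 0 < eigs G i
  · have := h i hp
    rw [dotProduct_comm x, this]; simp
  · have e : (b i : V → ℝ) ⬝ᵥ x = x ⬝ᵥ (b i : V → ℝ) := dotProduct_comm _ _
    rw [e]
    nlinarith [mul_self_nonneg (x ⬝ᵥ (b i : V → ℝ))]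

lemma core (G : SimpleGraph V) (c : V → Bool) (κ : V → ℕ)
    (hsame : ∀ u u', u ≠ u' → c u = c u' → G.Adj u u')
    (hκ : ∀ u u', c u = true → c u' = false → (G.Adj u u' ↔ κ u' < κ u))
    (hne : ∀ u u', c u = true → c u' = false → κ u' ≠ κ u)
    (hcard : 15 ≤ Fintype.card V)
    (hpos : Nat.card {i // 0 < eigs G i} ≤ 2) (hnull : 2 ≤ Nat.card {i // eigs G i = 0}) :
    False := by
  set l : List V := (Finset.univ : Finset V).toList.insertionSort (fun u u' => κ u ≤ κ u') with hl
  have hperm : l.Perm (Finset.univ : Finset V).toList := List.perm_insertionSort _ _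
  have hnd : l.Nodup := hperm.nodup_iff.2 (Finset.nodup_toList _)
  have hmem : ∀ u, u ∈ l := fun u => hperm.mem_iff.2 (by simp)
  have hlen : l.length = Fintype.card V := by rw [hperm.length_eq]; simp
  have hsum : ∀ f : V → ℝ, (l.map f).sum = ∑ u, f u := by
    intro f
    rw [(hperm.map f).sum_eq, Finset.sum_map_toList]
  have hsort : l.Pairwise (fun u u' => κ u ≤ κ u') := by
    haveI : Std.Total (fun u u' : V => κ u ≤ κ u') := ⟨fun a b => le_total _ _⟩
    haveI : IsTrans V (fun u u' : V => κ u ≤ κ u') := ⟨fun a b c => le_trans⟩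
    exact List.pairwise_insertionSort _ _
  have hcomp : Compat G c l := by
    refine (hsort.and hnd).imp ?_
    rintro u u' ⟨h1, h2⟩
    cases hu : c u <;> cases hu' : c u'
    · simpa using hsame u u' h2 (hu.trans hu'.symm)
    · have := (hκ u' u hu' hu).2 (lt_of_le_of_ne h1 (hne u' u hu' hu))
      simpa using this.symm
    · have := (hκ u u' hu hu')
      simp [this, h1]
    · simpa using hsame u u' h2 (hu.trans hu'.symm)
  -- null vectors
  have hact : ∀ α β, act (l.map c) α β = (β, β - α) := by
    have : Nontrivial {i // eigs G i = 0} := by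
      rw [← Finite.one_lt_card_iff_nontrivial]; omega
    obtain ⟨⟨i, hi⟩, ⟨j, hj⟩, hij⟩ := exists_pair_ne {i // eigs G i = 0}
    have hij : i ≠ j := fun h => hij (Subtype.ext h)
    set b := (adjMat_isHermitian G).eigenvectorBasis with hb
    have hz : ∀ i, eigs G i = 0 →
        ∀ u, (l.map fun u' => adjMat G u u' * (b i : V → ℝ) u').sum = 0 := by
      intro i hi u
      rw [hsum]
      have h3 := congrFun ((adjMat_isHermitian G).mulVec_eigenvectorBasis i) u
      have hi' : (adjMat_isHermitian G).eigenvalues i = 0 := hi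
      rw [hi', zero_smul] at h3
      exact h3
    refine act_of_null G c l hmem hcomp (b i) (b j) (hz i hi) (hz j hj) ?_
    intro s t hst
    have hst' : s • b i + t • b j = 0 := by
      ext u; exact congrFun hst u
    constructor
    · have := congrArg (fun z => inner ℝ (b i) z) hst'
      simpa [inner_add_right, inner_smul_right, b.inner_eq_ite, hij] using this
    · have := congrArg (fun z => inner ℝ (b j) z) hst'
      simpa [inner_add_right, inner_smul_right, b.inner_eq_ite, hij.symm] using this
  obtain ⟨D, hD, hDpos⟩ := pos3_of_act (l.map c) (by simpa [hlen] using hcard) hact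
  obtain ⟨φ, rfl⟩ := lift_deco c l hnd D hD
  set P : Matrix V (Fin 3) ℝ := Matrix.of φ
  set F : Matrix {i // 0 < eigs G i} V ℝ := Matrix.of fun i u =>
    ((adjMat_isHermitian G).eigenvectorBasis i.1 : EuclideanSpace ℝ V) u
  obtain ⟨a, ha, ha0⟩ : ∃ a : Fin 3 → ℝ, a ≠ 0 ∧ (F * P) *ᵥ a = 0 := by
    have hk : LinearMap.ker (F * P).mulVecLin ≠ ⊥ := by
      apply LinearMap.ker_ne_bot_of_finrank_lt
      simp only [Module.finrank_fintype_fun_eq_card, Fintype.card_fin]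
      rw [← Nat.card_eq_fintype_card]; omega
    obtain ⟨a, ha, ha'⟩ := Submodule.exists_mem_ne_zero_of_ne_bot hk
    exact ⟨a, ha', by simpa using ha⟩
  have h1 := hDpos a ha
  have h2 : evalD (l.map fun u => (c u, φ u)) a = l.map fun u => (c u, (P *ᵥ a) u) := by
    simp [evalD, Function.comp_def, P, mulVec]
  rw [h2, st_quad G c _ l hcomp, hsum] at h1
  simp only [hsum] at h1
  have h3 := quad_nonpos G (P *ᵥ a) (by
    intro i hi
    rw [← mulVec_mulVec] at ha0
    exact congrFun ha0 ⟨i, hi⟩)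
  exact absurd h1 (not_lt.2 h3)

lemma lam_counts (f : V → ℝ) (hcard : 4 ≤ Fintype.card V)
    (h3 : (((Finset.univ.val.map f).sort (· ≤ ·)).reverse).getD 2 0 = 0)
    (h4 : (((Finset.univ.val.map f).sort (· ≤ ·)).reverse).getD 3 0 = 0) :
    Nat.card {i // 0 < f i} ≤ 2 ∧ 2 ≤ Nat.card {i // f i = 0} := by
  classical
  have hcount : ∀ P : ℝ → Prop, [DecidablePred P] → Nat.card {i // P (f i)} =
      (((Finset.univ.val.map f).sort (· ≤ ·)).reverse).countP (fun x => decide (P x)) := by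
    intro P _
    rw [List.countP_reverse, ← Multiset.coe_countP, Multiset.sort_eq, Multiset.countP_map,
      Nat.card_eq_fintype_card, Fintype.card_subtype]
    rfl
  have hlen : (((Finset.univ.val.map f).sort (· ≤ ·)).reverse).length = Fintype.card V := by
    simp
  have hsort : (((Finset.univ.val.map f).sort (· ≤ ·)).reverse).Pairwise (fun a b => b ≤ a) := by
    rw [List.pairwise_reverse]
    exact Multiset.pairwise_sort _ _
  rw [hcount (fun x => 0 < x), hcount (fun x => x = 0)]
  generalize (((Finset.univ.val.map f).sort (· ≤ ·)).reverse) = L at *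
  match L, hlen with
  | a :: b :: c :: d :: t, _ =>
    simp only [List.getD_cons_succ, List.getD_cons_zero] at h3 h4
    subst h3 h4
    have ht : t.countP (fun x => decide (0 < x)) = 0 := by
      rw [List.countP_eq_zero]
      intro x hx
      have := (List.pairwise_cons.1 (List.pairwise_cons.1 (List.pairwise_cons.1 (List.pairwise_cons.1 hsort).2).2).2).1 x hx
      simpa using this
    constructor
    · simp only [List.countP_cons, ht]
      simp
      split_ifs <;> omega
    · simp only [List.countP_cons]
      simp
      omega
  | [], h => simp at h; omega
  | [_], h => simp at h; omega
  | [_, _], h => simp at h; omega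
  | [_, _, _], h => simp at h; omega

end

lemma part_one (k : ℕ) (nn : Fin k → ℕ) (hn : 15 ≤ ∑ i, nn i)
    (h3 : lam (bGraph k nn) 3 = 0) (h4 : lam (bGraph k nn) 4 = 0) : False := by
  letI := Fintype.ofFinite (Σ v : Fin ((k + 1) / 2) ⊕ Fin (k / 2), Fin (nn (toIdx v)))
  letI := Classical.decEq (Σ v : Fin ((k + 1) / 2) ⊕ Fin (k / 2), Fin (nn (toIdx v)))
  have hbij : Function.Bijective (toIdx (k := k)) := by
    constructor
    · rintro (⟨i, hi⟩ | ⟨i, hi⟩) (⟨j, hj⟩ | ⟨j, hj⟩) h <;> simp [toIdx] at h ⊢ <;> omega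
    · rintro ⟨i, hi⟩
      by_cases h : i < (k + 1) / 2
      · exact ⟨Sum.inl ⟨i, h⟩, rfl⟩
      · exact ⟨Sum.inr ⟨i - (k + 1) / 2, by omega⟩, by simp [toIdx]; omega⟩
  have hcard : 15 ≤ Fintype.card (Σ v : Fin ((k + 1) / 2) ⊕ Fin (k / 2), Fin (nn (toIdx v))) := by
    rw [← Nat.card_eq_fintype_card, Nat.card_sigma]
    simp only [Nat.card_eq_fintype_card, Fintype.card_fin]
    rw [hbij.sum_comp nn]
    exact hn
  obtain ⟨h1, h2⟩ := lam_counts (eigs (bGraph k nn)) (by omega) h3 h4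
  refine core (bGraph k nn) (fun s => s.1.isLeft)
    (fun s => Sum.elim (fun i : Fin ((k + 1) / 2) => 2 * (i : ℕ) + 1)
      (fun j : Fin (k / 2) => 2 * (k / 2 - (j : ℕ))) s.1)
    ?_ ?_ ?_ hcard h1 h2
  · rintro ⟨i | i, a⟩ ⟨j | j, b⟩ hne hc <;> simp at hc
    all_goals
      simp only [bGraph, lexProd, oboudi, SimpleGraph.fromRel_adj]
      refine ⟨hne, Or.inl ?_⟩
      by_cases hij : i = j
      · left; rw [hij]
      · right; simp [hij]
  · rintro ⟨i | i, a⟩ ⟨j | j, b⟩ h h' <;> simp at h h'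
    simp [bGraph, lexProd, oboudi, SimpleGraph.fromRel_adj]
  · rintro ⟨i | i, a⟩ ⟨j | j, b⟩ h h' <;> simp at h h'
    simp
    omega

lemma part_two (n s : ℕ) (hn : 15 ≤ n) (hs : 2 ≤ s) (G : SimpleGraph (Fin n))
    (hG : memClass s G) (v : Fin n) (hX : IsXComplete G v) (hR : IsReduced G v) : False := by
  classical
  obtain ⟨hp, hz⟩ := hG
  obtain ⟨-, hY, hXc⟩ := hX
  set d : Fin n → ℕ := fun u => (G.neighborSet u ∩ Yset G v).ncard with hd
  have hdn : ∀ u, d u ≤ n := fun u => by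
    have := Set.ncard_le_card (G.neighborSet u ∩ Yset G v)
    simpa using this
  set S : Fin n → Set ℕ := fun y =>
    insert (n + 1) {m | ∃ x, (x = v ∨ G.Adj v x) ∧ G.Adj x y ∧ m = d x} with hS
  have hv : G.neighborSet v ∩ Yset G v = ∅ := by
    ext u; simp [Yset]; tauto
  have hchain : ∀ x x', (x = v ∨ G.Adj v x) → (x' = v ∨ G.Adj v x') →
      G.neighborSet x ∩ Yset G v ⊆ G.neighborSet x' ∩ Yset G v ∨
      G.neighborSet x' ∩ Yset G v ⊆ G.neighborSet x ∩ Yset G v := by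
    rintro x x' (rfl | hx) (rfl | hx')
    · left; exact subset_rfl
    · left; rw [hv]; exact Set.empty_subset _
    · right; rw [hv]; exact Set.empty_subset _
    · exact hR x hx x' hx'
  letI : Fintype (Fin n) := Fintype.ofFinite (Fin n)
  letI : DecidableEq (Fin n) := Classical.decEq (Fin n)
  have hmemY : ∀ u, u ∈ Yset G v ↔ ¬ (u = v ∨ G.Adj v u) := by
    intro u; simp [Yset]
  refine core G (fun u => decide (u = v ∨ G.Adj v u))
    (fun u => if (u = v ∨ G.Adj v u) then 2 * d u + 1 else 2 * sInf (S u)) ?_ ?_ ?_ ?_ hp.le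
    (hs.trans hz.ge)
  · intro u u' hne hc
    simp only [decide_eq_decide] at hc
    by_cases hu : u = v ∨ G.Adj v u
    · have hu' := hc.1 hu
      rcases hu with rfl | hu <;> rcases hu' with rfl | hu'
      · exact absurd rfl hne
      · exact hu'
      · exact hu.symm
      · exact hXc hu hu' hne
    · exact hY ((hmemY u).2 hu) ((hmemY u').2 (fun h => hu (hc.2 h))) hne
  · intro x y hx hy
    simp only [decide_eq_true_eq, decide_eq_false_iff_not] at hx hy
    rw [if_pos hx, if_neg hy]
    constructor
    · intro h
      have : sInf (S y) ≤ d x := Nat.sInf_le (Or.inr ⟨x, hx, h, rfl⟩)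
      omega
    · intro h
      have hm : sInf (S y) ∈ S y := Nat.sInf_mem ⟨n + 1, Or.inl rfl⟩
      have hle : sInf (S y) ≤ d x := by omega
      rcases hm with hm | ⟨x0, hx0, hadj, hm⟩
      · have := hdn x; omega
      · rw [hm] at hle
        have hy0 : y ∈ G.neighborSet x0 ∩ Yset G v := ⟨hadj, (hmemY y).2 hy⟩
        rcases hchain x0 x hx0 hx with h | h
        · exact (h hy0).1
        · have := Set.eq_of_subset_of_ncard_le h hle (Set.toFinite _)
          rw [← this] at hy0
          exact hy0.1
  · intro x y hx hy
    simp only [decide_eq_true_eq, decide_eq_false_iff_not] at hx hy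
    rw [if_pos hx, if_neg hy]
    omega
  · rw [← Nat.card_eq_fintype_card, Nat.card_fin]; exact hn

theorem B00_empty_large_order :
    (∀ (k : ℕ), 4 ≤ k → k ≤ 14 → ∀ (nn : Fin k → ℕ), (∀ i, 1 ≤ nn i) →
      15 ≤ ∑ i, nn i →
      ¬ (lam (bGraph k nn) 3 = 0 ∧ lam (bGraph k nn) 4 = 0)) ∧
    (∀ (n s : ℕ), 15 ≤ n → 2 ≤ s → s ≤ n - 3 → ∀ G : SimpleGraph (Fin n),
      G.Connected → memClass s G → ∀ v : Fin n, IsMinDegVertex G v →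
      ¬ (IsXComplete G v ∧ IsReduced G v)) := by
  refine ⟨fun k _ _ nn _ hn h => part_one k nn hn h.1 h.2, ?_⟩
  intro n s hn hs _ G _ hG v _ h
  exact part_two n s hn hs G hG v h.1 h.2

end TwoPosEig
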